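/- Fix η,δ∈(0,1). There exist constants c_a∈(0,1), c_b>0 and C_P<∞, depending only on η and δ, such that for all N ≥ C_P, κ>0, integers P∈[C_P,N], sets A⊆{1,…,P} with n=|A| satisfying c_aP ≤ n ≤ P, and nonempty finite sets S_i⊆G (i∈A) with cap(S_i) ≥ κ for each i∈A, the following holds: if d(S_i,S_j) ≥ (|i−j|−δ)·N/P for all i≠j∈A, then cap(∪_{i∈A}S_i) ≥ (1/(c_b·κ·P) + (1+η)/(c₆·F_ν(N,N/P)))^{−1}, where c₆=c_β if ν≤1 and c₆=c₆(η,δ)>0 if ν>1. -/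

import Mathlib

open MeasureTheory Set Filter
open scoped ENNReal Topology Classical

noncomputable section

namespace Paper

variable {V : Type}

/-- Total weight at a vertex: `λ_x = ∑_y λ_{x,y}`. -/
def lamTot (lam : V → V → ℝ) (x : V) : ℝ := ∑' y, lam x y

/-- Closed ball for the distance `dd`. -/
def vball (dd : V → V → ℝ) (x : V) (r : ℝ) : Set V := {y | dd x y ≤ r}

/-- Trajectories that never return to `A` after time `0`, i.e. `H̃_A = ∞`. -/
def avoidSet (A : Set V) : Set (ℕ → V) := {ω | ∀ k, 1 ≤ k → ω k ∉ A}

variable [MeasurableSpace V]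

/-- Equilibrium measure `e_A(x) = λ_x P_x(H̃_A = ∞) 1{x ∈ A}`. -/
def equi (lam : V → V → ℝ) (P : V → Measure (ℕ → V)) (A : Set V) (x : V) : ℝ :=
  if x ∈ A then lamTot lam x * (P x (avoidSet A)).toReal else 0

/-- Capacity `cap(A) = ∑_{x ∈ A} e_A(x)`. -/
def capa (lam : V → V → ℝ) (P : V → Measure (ℕ → V)) (A : Set V) : ℝ :=
  ∑' x : A, equi lam P A x

/-- Green function `g(x,y) = λ_y⁻¹ E_x[∑_k 1{X_k = y}]`. -/
def green (lam : V → V → ℝ) (P : V → Measure (ℕ → V)) (x y : V) : ℝ :=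
  (lamTot lam y)⁻¹ * ∑' k : ℕ, (P x {ω | ω k = y}).toReal

/-- The standing assumptions on the weighted graph `(G,λ)` with distance `dd`,
random-walk law `P`, volume exponent `α`, Green exponent `ν` and asymptotic
Green constants `c₃ ≤ C₃`. -/
structure Standing (lam dd : V → V → ℝ) (P : V → Measure (ℕ → V))
    (α ν c₃ C₃ : ℝ) : Prop where
  countable : Countable V
  lam_symm : ∀ x y, lam x y = lam y x
  lam_nonneg : ∀ x y, 0 ≤ lam x y
  lam_diag : ∀ x, lam x x = 0
  locFin : ∀ x, {y | 0 < lam x y}.Finite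
  dd_self : ∀ x, dd x x = 0
  dd_pos : ∀ x y, x ≠ y → 0 < dd x y
  dd_symm : ∀ x y, dd x y = dd y x
  dd_triangle : ∀ x y z, dd x z ≤ dd x y + dd y z
  prob : ∀ x, IsProbabilityMeasure (P x)
  start : ∀ x, P x {ω | ω 0 = x} = 1
  step : ∀ x y, P x {ω | ω 1 = y} = ENNReal.ofReal (lam x y / lamTot lam x)
  markov : ∀ (x y : V) (k : ℕ) (S : Set (ℕ → V)), MeasurableSet S →
    P x ({ω | ω k = y} ∩ {ω | (fun n => ω (k + n)) ∈ S}) = P x {ω | ω k = y} * P y S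
  nu_pos : 0 < ν
  nu_le : ν ≤ α - 2
  vol : ∃ c₁ C₁ : ℝ, 0 < c₁ ∧ c₁ ≤ C₁ ∧ ∀ (x : V) (r : ℝ), 1 ≤ r →
    c₁ * r ^ α ≤ ∑' y : vball dd x r, lamTot lam y ∧
      ∑' y : vball dd x r, lamTot lam y ≤ C₁ * r ^ α
  greenBounds : ∃ c₂ C₂ : ℝ, 0 < c₂ ∧ c₂ ≤ C₂ ∧
    (∀ x, c₂ ≤ green lam P x x ∧ green lam P x x ≤ C₂) ∧
    ∀ x y, x ≠ y → c₂ * dd x y ^ (-ν) ≤ green lam P x y ∧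
      green lam P x y ≤ C₂ * dd x y ^ (-ν)
  c₃_pos : 0 < c₃
  c₃_le_C₃ : c₃ ≤ C₃
  greenAsymp : ∀ η' : ℝ, 0 < η' → ∃ M : ℝ, ∀ x y, M ≤ dd x y →
    (1 - η') * c₃ ≤ green lam P x y * dd x y ^ ν ∧
      green lam P x y * dd x y ^ ν ≤ (1 + η') * C₃
  p0 : ∃ c : ℝ, 0 < c ∧ ∀ x y, 0 < lam x y → c ≤ lam x y / lamTot lam x

/-- The geodesic assumption: from every point there is an infinite
nearest-neighbour path along which `dd` is comparable to the index difference. -/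
def Geodesic (lam dd : V → V → ℝ) (c₄ C₄ : ℝ) : Prop :=
  ∀ x : V, ∃ γ : ℕ → V, γ 0 = x ∧ (∀ k : ℕ, 0 < lam (γ k) (γ (k + 1))) ∧
    ∀ k p : ℕ, c₄ * |(k : ℝ) - (p : ℝ)| - C₄ ≤ dd (γ k) (γ p) ∧
      dd (γ k) (γ p) ≤ c₄ * |(k : ℝ) - (p : ℝ)| + C₄

/-- The function `F_ν(x,y)`. -/
def Fnu (ν x y : ℝ) : ℝ :=
  if ν < 1 then x ^ ν
  else if ν = 1 then x / max 1 (Real.log (x / y))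
  else x * y ^ (ν - 1)

/-- `F_ν(x) = F_ν(x,1)`. -/
def Fnu1 (ν x : ℝ) : ℝ := Fnu ν x 1

/-- The constant `π⁻¹ B((1+ν)/2,(1+ν)/2) cos(πν/2)` for `ν < 1` and `1/2` for `ν = 1`
(the Beta function expressed through `Γ`). -/
def kappaNu (ν : ℝ) : ℝ :=
  if ν < 1 then
    Real.Gamma ((1 + ν) / 2) * Real.Gamma ((1 + ν) / 2) / Real.Gamma (1 + ν)
      * Real.cos (Real.pi * ν / 2) / Real.pi
  else 1 / 2

/-- `c_β`, defined by `c_β · C₃ = kappaNu ν`. -/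
def cBeta (ν C₃ : ℝ) : ℝ := kappaNu ν / C₃

/-- `C_β`, defined by `C_β · c₃ = kappaNu ν`. -/
def CBeta (ν c₃ : ℝ) : ℝ := kappaNu ν / c₃

/-- `a` and `b` are joined by a nearest-neighbour path inside `S`. -/
def connIn (lam : V → V → ℝ) (S : Set V) (a b : V) : Prop :=
  ∃ (m : ℕ) (γ : ℕ → V), γ 0 = a ∧ γ m = b ∧ (∀ i ≤ m, γ i ∈ S) ∧
    ∀ i < m, 0 < lam (γ i) (γ (i + 1))

/-- The set `X̄_A` of points visited by a trajectory strictly before exiting `A`. -/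
def visited (A : Set V) (ω : ℕ → V) : Set V :=
  {v | ∃ k : ℕ, (∀ n ≤ k, ω n ∈ A) ∧ ω k = v}

namespace Standing

variable {lam dd : V → V → ℝ} {P : V → Measure (ℕ → V)} {α ν c₃ C₃ : ℝ}

lemma summable_lam (h : Standing lam dd P α ν c₃ C₃) (x : V) : Summable (lam x) := by
  refine summable_of_hasFiniteSupport ((h.locFin x).subset fun y hy => ?_)
  exact lt_of_le_of_ne (h.lam_nonneg x y) (Ne.symm hy)

lemma lamTot_pos (h : Standing lam dd P α ν c₃ C₃) (x : V) : 0 < lamTot lam x := by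
  have := h.countable
  have := h.prob x
  by_contra hx
  have h0 : lamTot lam x = 0 := le_antisymm (not_lt.mp hx) (tsum_nonneg (h.lam_nonneg x))
  have h1 : (1 : ℝ≥0∞) ≤ ∑' y, P x {ω | ω 1 = y} := by
    rw [← measure_univ (μ := P x)]
    refine (measure_mono fun ω _ => ?_).trans (measure_iUnion_le _)
    exact mem_iUnion.mpr ⟨ω 1, rfl⟩
  simp [h.step, h0] at h1

lemma tsum_step (h : Standing lam dd P α ν c₃ C₃) (x : V) :
    ∑' y, ENNReal.ofReal (lam x y / lamTot lam x) = 1 := by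
  have hx := h.lamTot_pos x
  rw [← ENNReal.ofReal_tsum_of_nonneg (fun y => div_nonneg (h.lam_nonneg x y) hx.le)
    ((h.summable_lam x).div_const _), tsum_div_const]
  change ENNReal.ofReal (lamTot lam x / lamTot lam x) = 1
  rw [div_self hx.ne', ENNReal.ofReal_one]

/-- The law of the first step forces the measurable structure to separate points. -/
lemma separatesPoints (h : Standing lam dd P α ν c₃ C₃) :
    MeasurableSpace.SeparatesPoints V := by
  have := h.countable
  refine ⟨fun y y' hs => ?_⟩
  by_contra hne
  have key : ∀ x, lam x y' = 0 := by
    intro x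
    have := h.prob x
    have hle : (1 : ℝ≥0∞) ≤
        ∑' z, if z = y' then 0 else ENNReal.ofReal (lam x z / lamTot lam x) := by
      rw [← measure_univ (μ := P x)]
      refine (measure_mono fun ω _ => ?_).trans ((measure_iUnion_le
        (fun z => if z = y' then ∅ else toMeasurable (P x) {ω : ℕ → V | ω 1 = z})).trans
          (ENNReal.tsum_le_tsum fun z => ?_))
      · rw [mem_iUnion]
        by_cases hω : ω 1 = y'
        · refine ⟨y, ?_⟩
          rw [if_neg hne]
          have hm : MeasurableSet ((fun v => Function.update ω 1 v) ⁻¹'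
              toMeasurable (P x) {ω : ℕ → V | ω 1 = y}) :=
            (measurable_update ω) (measurableSet_toMeasurable _ _)
          have hy := hs _ hm (subset_toMeasurable _ _ (by simp))
          rw [mem_preimage, ← hω, Function.update_eq_self] at hy
          exact hy
        · refine ⟨ω 1, ?_⟩
          rw [if_neg hω]
          exact subset_toMeasurable _ _ rfl
      · split_ifs
        · simp
        · rw [measure_toMeasurable, h.step]
    have htot := h.tsum_step x
    rw [ENNReal.tsum_eq_add_tsum_ite y'] at htot
    have h0 : ENNReal.ofReal (lam x y' / lamTot lam x) = 0 := by
      have h2 : ENNReal.ofReal (lam x y' / lamTot lam x) + 1 ≤ 0 + 1 := by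
        rw [zero_add]
        exact (add_le_add_right hle _).trans htot.le
      exact le_antisymm ((ENNReal.add_le_add_iff_right ENNReal.one_ne_top).mp h2) bot_le
    rw [ENNReal.ofReal_eq_zero] at h0
    have h3 := (div_le_iff₀ (h.lamTot_pos x)).mp h0
    rw [zero_mul] at h3
    exact le_antisymm h3 (h.lam_nonneg x y')
  have hz : lamTot lam y' = 0 := by
    simp [lamTot, h.lam_symm y', key]
  exact (h.lamTot_pos y').ne' hz

lemma discreteMeasurableSpace (h : Standing lam dd P α ν c₃ C₃) :
    DiscreteMeasurableSpace V := by
  have := h.countable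
  have := h.separatesPoints
  infer_instance

lemma measurableSet_coord (h : Standing lam dd P α ν c₃ C₃) (k : ℕ) (s : Set V) :
    MeasurableSet {ω : ℕ → V | ω k ∈ s} := by
  have := h.discreteMeasurableSpace
  exact measurable_pi_apply k (MeasurableSet.of_discrete (s := s))

lemma measurableSet_coord_eq (h : Standing lam dd P α ν c₃ C₃) (k : ℕ) (y : V) :
    MeasurableSet {ω : ℕ → V | ω k = y} :=
  h.measurableSet_coord k {y}

lemma measurableSet_avoidSet (h : Standing lam dd P α ν c₃ C₃) (K : Set V) :
    MeasurableSet (avoidSet K) := by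
  have : avoidSet K = ⋂ k : ℕ, ⋂ _ : 1 ≤ k, {ω : ℕ → V | ω k ∈ Kᶜ} := by
    ext ω
    simp [avoidSet]
  rw [this]
  exact MeasurableSet.iInter fun k => MeasurableSet.iInter fun _ => h.measurableSet_coord k _

lemma prob_zero (h : Standing lam dd P α ν c₃ C₃) (x y : V) :
    P x {ω | ω 0 = y} = if x = y then 1 else 0 := by
  have := h.prob x
  split_ifs with hxy
  · rw [← hxy, h.start]
  · have hc := (prob_compl_eq_zero_iff (h.measurableSet_coord_eq 0 x)).mpr (h.start x)
    refine measure_mono_null (fun ω hω => ?_) hc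
    intro hx
    exact hxy (hx.symm.trans hω)

/-- Chapman–Kolmogorov. -/
lemma prob_add (h : Standing lam dd P α ν c₃ C₃) (x y : V) (k l : ℕ) :
    P x {ω | ω (k + l) = y} = ∑' z, P x {ω | ω k = z} * P z {ω | ω l = y} := by
  have := h.countable
  have hU : {ω : ℕ → V | ω (k + l) = y} =
      ⋃ z, ({ω | ω k = z} ∩ {ω | (fun n => ω (k + n)) ∈ {ω : ℕ → V | ω l = y}}) := by
    ext ω
    simp
  have hshift : Measurable fun (ω : ℕ → V) (n : ℕ) => ω (k + n) :=
    measurable_pi_lambda _ fun n => measurable_pi_apply _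
  rw [hU, measure_iUnion]
  · exact tsum_congr fun z => h.markov x z k _ (h.measurableSet_coord_eq l y)
  · intro z z' hz
    refine Set.disjoint_left.mpr fun ω hω hω' => hz ?_
    exact hω.1.symm.trans hω'.1
  · exact fun z => (h.measurableSet_coord_eq k z).inter (hshift (h.measurableSet_coord_eq l y))

lemma reversible (h : Standing lam dd P α ν c₃ C₃) (k : ℕ) : ∀ x y : V,
    ENNReal.ofReal (lamTot lam x) * P x {ω | ω k = y} =
      ENNReal.ofReal (lamTot lam y) * P y {ω | ω k = x} := by
  have h1 : ∀ x y : V, ENNReal.ofReal (lamTot lam x) * P x {ω | ω 1 = y} =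
      ENNReal.ofReal (lamTot lam y) * P y {ω | ω 1 = x} := by
    intro x y
    have hx := h.lamTot_pos x
    have hy := h.lamTot_pos y
    rw [h.step, h.step, ← ENNReal.ofReal_mul hx.le, ← ENNReal.ofReal_mul hy.le,
      mul_div_cancel₀ _ hx.ne', mul_div_cancel₀ _ hy.ne', h.lam_symm]
  induction k with
  | zero =>
    intro x y
    rw [h.prob_zero, h.prob_zero]
    by_cases hxy : x = y
    · rw [hxy]
    · rw [if_neg hxy, if_neg (Ne.symm hxy), mul_zero, mul_zero]
  | succ k ih =>
    intro x y
    rw [h.prob_add y x k 1, add_comm k 1, h.prob_add x y 1 k, ← ENNReal.tsum_mul_left,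
      ← ENNReal.tsum_mul_left]
    refine tsum_congr fun z => ?_
    rw [← mul_assoc, h1, mul_comm (ENNReal.ofReal (lamTot lam z)), mul_assoc, ih, mul_comm,
      mul_assoc]

lemma green_symm (h : Standing lam dd P α ν c₃ C₃) (x y : V) :
    green lam P x y = green lam P y x := by
  have hx := h.lamTot_pos x
  have hy := h.lamTot_pos y
  have hrev : ∀ k, lamTot lam x * (P x {ω | ω k = y}).toReal =
      lamTot lam y * (P y {ω | ω k = x}).toReal := by
    intro k
    have := congrArg ENNReal.toReal (h.reversible k x y)
    rwa [ENNReal.toReal_mul, ENNReal.toReal_mul, ENNReal.toReal_ofReal hx.le,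
      ENNReal.toReal_ofReal hy.le] at this
  have hsum : lamTot lam x * ∑' k : ℕ, (P x {ω | ω k = y}).toReal =
      lamTot lam y * ∑' k : ℕ, (P y {ω | ω k = x}).toReal := by
    rw [← tsum_mul_left, ← tsum_mul_left]
    exact tsum_congr hrev
  rw [green, green]
  field_simp
  rw [mul_comm]
  exact hsum

lemma green_pos (h : Standing lam dd P α ν c₃ C₃) (x y : V) : 0 < green lam P x y := by
  obtain ⟨c₂, C₂, hc₂, -, hd, ho⟩ := h.greenBounds
  by_cases hxy : x = y
  · rw [← hxy]
    exact hc₂.trans_le (hd x).1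
  · exact (mul_pos hc₂ (Real.rpow_pos_of_pos (h.dd_pos x y hxy) _)).trans_le (ho x y hxy).1

lemma summable_prob (h : Standing lam dd P α ν c₃ C₃) (x y : V) :
    Summable fun k : ℕ => (P x {ω | ω k = y}).toReal := by
  by_contra hs
  have := h.green_pos x y
  rw [green, tsum_eq_zero_of_not_summable hs, mul_zero] at this
  exact lt_irrefl _ this

lemma tsum_prob (h : Standing lam dd P α ν c₃ C₃) (x y : V) :
    ∑' k : ℕ, P x {ω | ω k = y} = ENNReal.ofReal (green lam P x y * lamTot lam y) := by
  have := h.prob x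
  have h1 : green lam P x y * lamTot lam y = ∑' k : ℕ, (P x {ω | ω k = y}).toReal := by
    have := (h.lamTot_pos y).ne'
    rw [green]
    field_simp
  rw [h1, ENNReal.ofReal_tsum_of_nonneg (fun _ => ENNReal.toReal_nonneg) (h.summable_prob x y)]
  exact tsum_congr fun k => (ENNReal.ofReal_toReal (measure_ne_top _ _)).symm

/-- The walk almost surely visits a finite set only finitely often. -/
lemma ae_finite_visits (h : Standing lam dd P α ν c₃ C₃) (x : V) (K : Finset V) :
    ∀ᵐ ω ∂P x, {k : ℕ | ω k ∈ K}.Finite := by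
  refine ae_finite_setOfPred_mem (s := fun k : ℕ => {ω : ℕ → V | ω k ∈ K}) ?_
  have hle : ∑' k : ℕ, P x {ω | ω k ∈ K} ≤ ∑ y ∈ K, ∑' k : ℕ, P x {ω | ω k = y} := by
    rw [← Summable.tsum_finsetSum fun _ _ => ENNReal.summable]
    refine ENNReal.tsum_le_tsum fun k => ?_
    refine (measure_mono fun ω hω => ?_).trans (measure_biUnion_finset_le K _)
    exact mem_iUnion₂.mpr ⟨ω k, hω, rfl⟩
  refine ne_top_of_le_ne_top ?_ hle
  rw [ENNReal.sum_ne_top]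
  intro y _
  rw [h.tsum_prob]
  exact ENNReal.ofReal_ne_top

/-- Last-exit decomposition: the equilibrium potential equals `1` on the set. -/
lemma sum_green_mul_equi (h : Standing lam dd P α ν c₃ C₃) (K : Finset V) {z : V} (hz : z ∈ K) :
    ∑ x ∈ K, green lam P z x * equi lam P (K : Set V) x = 1 := by
  have := h.countable
  have := h.prob z
  let E : ℕ × V → Set (ℕ → V) := fun p =>
    if p.2 ∈ K then {ω | ω p.1 = p.2} ∩ {ω | (fun n => ω (p.1 + n)) ∈ avoidSet (K : Set V)} else ∅
  have hEm : ∀ p, MeasurableSet (E p) := by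
    intro p
    have hshift : Measurable fun (ω : ℕ → V) (n : ℕ) => ω (p.1 + n) :=
      measurable_pi_lambda _ fun n => measurable_pi_apply _
    simp only [E]
    split_ifs
    · exact (h.measurableSet_coord_eq _ _).inter (hshift (h.measurableSet_avoidSet _))
    · exact MeasurableSet.empty
  have hlt : ∀ (p q : ℕ × V) (ω : ℕ → V), ω ∈ E p → ω ∈ E q → ¬ p.1 < q.1 := by
    intro p q ω hp hq hpq
    simp only [E] at hp hq
    split_ifs at hp hq with h1 h2 h2
    · refine hp.2 (q.1 - p.1) (by omega) ?_
      change ω (p.1 + (q.1 - p.1)) ∈ K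
      rw [show p.1 + (q.1 - p.1) = q.1 by omega, hq.1]
      exact h2
    all_goals simp_all
  have hdisj : Pairwise (Function.onFun Disjoint E) := by
    intro p q hpq
    refine Set.disjoint_left.mpr fun ω hp hq => hpq ?_
    have h1 : p.1 = q.1 :=
      le_antisymm (not_lt.mp (hlt q p ω hq hp)) (not_lt.mp (hlt p q ω hp hq))
    refine Prod.ext h1 ?_
    simp only [E] at hp hq
    split_ifs at hp hq
    · rw [← hp.1, ← hq.1, h1]
    all_goals simp_all
  have hcover : P z (⋃ p, E p) = 1 := by
    rw [← measure_univ (μ := P z)]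
    refine measure_congr ?_
    have hstart : ∀ᵐ ω ∂P z, ω 0 = z :=
      (prob_compl_eq_zero_iff (h.measurableSet_coord_eq 0 z)).mpr (h.start z)
    filter_upwards [h.ae_finite_visits z K, hstart] with ω hfin h0
    refine propext ⟨fun _ => trivial, fun _ => ?_⟩
    obtain ⟨m, hm, hmax⟩ := hfin.exists_maximal ⟨0, by simpa [h0] using hz⟩
    refine mem_iUnion.mpr ⟨(m, ω m), ?_⟩
    have hm' : ω m ∈ K := hm
    simp only [E, if_pos hm']
    refine ⟨rfl, fun k hk hin => ?_⟩
    have : m + k ≤ m := hmax (show ω (m + k) ∈ K from hin) (by omega)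
    omega
  rw [measure_iUnion hdisj hEm, ENNReal.tsum_prod (f := fun k x => P z (E (k, x))),
    ENNReal.tsum_comm] at hcover
  have hterm : ∀ x, ∑' k : ℕ, P z (E (k, x)) =
      if x ∈ K then ENNReal.ofReal (green lam P z x * equi lam P (K : Set V) x) else 0 := by
    intro x
    have := h.prob x
    by_cases hx : x ∈ K
    · simp only [E, if_pos hx]
      rw [tsum_congr fun k => h.markov z x k _ (h.measurableSet_avoidSet _),
        ENNReal.tsum_mul_right, h.tsum_prob, equi, if_pos (Finset.mem_coe.mpr hx), ← mul_assoc,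
        ENNReal.ofReal_mul (p := green lam P z x * lamTot lam x)
          (mul_nonneg (h.green_pos z x).le (h.lamTot_pos x).le),
        ENNReal.ofReal_toReal (measure_ne_top _ _)]
    · simp [E, hx]
  simp_rw [hterm] at hcover
  rw [tsum_eq_sum (s := K) fun x hx => if_neg hx,
    Finset.sum_congr rfl fun x hx => if_pos hx] at hcover
  have hnn : ∀ x ∈ K, 0 ≤ green lam P z x * equi lam P (K : Set V) x := by
    intro x _
    refine mul_nonneg (h.green_pos z x).le ?_
    rw [equi]
    split_ifs
    · exact mul_nonneg (h.lamTot_pos x).le ENNReal.toReal_nonneg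
    · exact le_rfl
  rw [← ENNReal.ofReal_sum_of_nonneg hnn] at hcover
  rwa [ENNReal.ofReal_eq_one] at hcover

lemma equi_nonneg (h : Standing lam dd P α ν c₃ C₃) (K : Set V) (x : V) :
    0 ≤ equi lam P K x := by
  rw [equi]
  split_ifs
  · exact mul_nonneg (h.lamTot_pos x).le ENNReal.toReal_nonneg
  · exact le_rfl

end Standing

lemma capa_coe_finset (lam : V → V → ℝ) (P : V → Measure (ℕ → V)) (K : Finset V) :
    capa lam P (K : Set V) = ∑ x ∈ K, equi lam P (K : Set V) x := by
  rw [capa]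
  exact Finset.tsum_subtype K (equi lam P (K : Set V))

/-- A weighted sum of normalised equilibrium measures whose potential is at most `M` on the union
of the sets bounds the capacity of the union from below. -/
lemma Standing.sum_le_mul_capa {lam dd : V → V → ℝ} {P : V → Measure (ℕ → V)} {α ν c₃ C₃ : ℝ}
    (h : Standing lam dd P α ν c₃ C₃) {ι : Type*} [DecidableEq ι] (A : Finset ι) (S : ι → Finset V)
    {κ M : ℝ} (hκ : 0 < κ) (hcap : ∀ i ∈ A, κ ≤ capa lam P (S i : Set V))
    (β : ι → ℝ) (hβ : ∀ i ∈ A, 0 ≤ β i) (Γ : ι → ι → ℝ)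
    (hΓ : ∀ i ∈ A, ∀ j ∈ A, i ≠ j → ∀ y ∈ S i, ∀ z ∈ S j, green lam P y z ≤ Γ i j)
    (hM : ∀ j ∈ A, β j / κ + ∑ i ∈ A.erase j, β i * Γ i j ≤ M) :
    ∑ i ∈ A, β i ≤ M * capa lam P (A.biUnion S : Set V) := by
  set K : Finset V := A.biUnion S with hK
  let cap : ι → ℝ := fun i => capa lam P (S i : Set V)
  let e : ι → V → ℝ := fun i => equi lam P (S i : Set V)
  have hcap_pos : ∀ i ∈ A, 0 < cap i := fun i hi => hκ.trans_le (hcap i hi)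
  have hcap_eq : ∀ i, cap i = ∑ y ∈ S i, e i y := fun i => capa_coe_finset lam P (S i)
  have hpot : ∀ x ∈ K, ∑ i ∈ A, β i * ((cap i)⁻¹ * ∑ y ∈ S i, e i y * green lam P y x) ≤ M := by
    intro x hx
    obtain ⟨j, hj, hxj⟩ := Finset.mem_biUnion.mp hx
    refine le_trans ?_ (hM j hj)
    rw [← Finset.add_sum_erase A _ hj]
    refine add_le_add ?_ (Finset.sum_le_sum fun i hi => ?_)
    · have h1 : ∑ y ∈ S j, e j y * green lam P y x = 1 := by
        rw [← h.sum_green_mul_equi (S j) hxj]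
        exact Finset.sum_congr rfl fun y _ => by rw [h.green_symm y x, mul_comm]
      rw [h1, mul_one, div_eq_mul_inv]
      exact mul_le_mul_of_nonneg_left (inv_anti₀ hκ (hcap j hj)) (hβ j hj)
    · obtain ⟨hij, hiA⟩ := Finset.mem_erase.mp hi
      refine mul_le_mul_of_nonneg_left ?_ (hβ i hiA)
      rw [inv_mul_le_iff₀ (hcap_pos i hiA), hcap_eq, Finset.sum_mul]
      exact Finset.sum_le_sum fun y hy => mul_le_mul_of_nonneg_left
        (hΓ i hiA j hj hij y hy x hxj) (h.equi_nonneg _ _)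
  have hmass : ∀ i ∈ A, β i = ∑ x ∈ K, equi lam P (K : Set V) x *
      (β i * ((cap i)⁻¹ * ∑ y ∈ S i, e i y * green lam P y x)) := by
    intro i hi
    have h1 : ∑ x ∈ K, equi lam P (K : Set V) x * ∑ y ∈ S i, e i y * green lam P y x = cap i := by
      simp_rw [Finset.mul_sum]
      rw [Finset.sum_comm, hcap_eq]
      refine Finset.sum_congr rfl fun y hy => ?_
      have hyK : y ∈ K := Finset.mem_biUnion.mpr ⟨i, hi, hy⟩
      calc _ = e i y * ∑ x ∈ K, green lam P y x * equi lam P (K : Set V) x := by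
            rw [Finset.mul_sum]
            exact Finset.sum_congr rfl fun x _ => by ring
        _ = e i y := by rw [h.sum_green_mul_equi K hyK, mul_one]
    calc β i = β i * ((cap i)⁻¹ * cap i) := by
          rw [inv_mul_cancel₀ (hcap_pos i hi).ne', mul_one]
      _ = _ := by
          rw [← h1, Finset.mul_sum, Finset.mul_sum]
          exact Finset.sum_congr rfl fun x _ => by ring
  calc ∑ i ∈ A, β i = ∑ x ∈ K, equi lam P (K : Set V) x *
        ∑ i ∈ A, β i * ((cap i)⁻¹ * ∑ y ∈ S i, e i y * green lam P y x) := by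
        rw [Finset.sum_congr rfl hmass, Finset.sum_comm]
        simp_rw [← Finset.mul_sum]
    _ ≤ ∑ x ∈ K, equi lam P (K : Set V) x * M :=
        Finset.sum_le_sum fun x hx => mul_le_mul_of_nonneg_left (hpot x hx) (h.equi_nonneg _ _)
    _ = M * capa lam P (A.biUnion S : Set V) := by
        rw [← Finset.sum_mul, mul_comm, capa_coe_finset]

lemma lintegral_beta {a b : ℝ} (ha : 0 < a) (hb : 0 < b) :
    ∫⁻ t in Ioo (0 : ℝ) 1, ENNReal.ofReal (t ^ (a - 1) * (1 - t) ^ (b - 1)) =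
      ENNReal.ofReal (ProbabilityTheory.beta a b) := by
  have hB := ProbabilityTheory.beta_pos ha hb
  have h1 := ProbabilityTheory.lintegral_betaPDF_eq_one ha hb
  rw [ProbabilityTheory.lintegral_betaPDF] at h1
  simp_rw [mul_assoc, ENNReal.ofReal_mul (one_div_pos.mpr hB).le] at h1
  rw [lintegral_const_mul' _ _ ENNReal.ofReal_ne_top] at h1
  calc _ = ENNReal.ofReal (ProbabilityTheory.beta a b) *
        (ENNReal.ofReal (1 / ProbabilityTheory.beta a b) *
          ∫⁻ t in Ioo (0 : ℝ) 1, ENNReal.ofReal (t ^ (a - 1) * (1 - t) ^ (b - 1))) := by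
        rw [← mul_assoc, ← ENNReal.ofReal_mul hB.le, mul_one_div_cancel hB.ne',
          ENNReal.ofReal_one, one_mul]
    _ = _ := by rw [h1, mul_one]

lemma image_Ioo_eq {f g : ℝ → ℝ} {a b c d : ℝ} (hf : MapsTo f (Ioo a b) (Ioo c d))
    (hg : MapsTo g (Ioo c d) (Ioo a b)) (hfg : ∀ v ∈ Ioo c d, f (g v) = v) :
    f '' Ioo a b = Ioo c d :=
  hf.image_subset.antisymm fun v hv => ⟨g v, hg hv, hfg v hv⟩

lemma lintegral_beta_Ioo {a b s u : ℝ} (ha : 0 < a) (hb : 0 < b) (hsu : s < u) :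
    ∫⁻ y in Ioo s u, ENNReal.ofReal ((y - s) ^ (a - 1) * (u - y) ^ (b - 1)) =
      ENNReal.ofReal ((u - s) ^ (a + b - 1) * ProbabilityTheory.beta a b) := by
  have hd : 0 < u - s := sub_pos.mpr hsu
  have himg : (fun y => (y - s) / (u - s)) '' Ioo s u = Ioo 0 1 := by
    refine image_Ioo_eq (g := fun v => s + v * (u - s)) ?_ ?_ ?_
    · rintro y ⟨h1, h2⟩
      exact ⟨div_pos (by linarith) hd, (div_lt_one hd).mpr (by linarith)⟩
    · rintro v ⟨h1, h2⟩
      constructor <;> dsimp only <;> nlinarith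
    · intro v _
      field_simp
      ring
  have hinj : InjOn (fun y => (y - s) / (u - s)) (Ioo s u) := by
    intro y _ y' _ h
    have := (div_left_inj' hd.ne').mp h
    linarith
  have hderiv : ∀ y ∈ Ioo s u, HasDerivWithinAt (fun y => (y - s) / (u - s))
      (1 / (u - s)) (Ioo s u) y := fun y _ =>
    (((hasDerivAt_id y).sub_const s).div_const (u - s)).hasDerivWithinAt
  have key := lintegral_image_eq_lintegral_abs_deriv_mul measurableSet_Ioo hderiv hinj
    (fun t => ENNReal.ofReal (t ^ (a - 1) * (1 - t) ^ (b - 1)))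
  rw [himg, lintegral_beta ha hb] at key
  rw [ENNReal.ofReal_mul (Real.rpow_nonneg hd.le _), key,
    ← lintegral_const_mul' _ _ ENNReal.ofReal_ne_top]
  refine setLIntegral_congr_fun measurableSet_Ioo fun y hy => ?_
  have h1 : 0 < y - s := sub_pos.mpr hy.1
  have h2 : 0 < u - y := sub_pos.mpr hy.2
  rw [← ENNReal.ofReal_mul (abs_nonneg _), ← ENNReal.ofReal_mul (Real.rpow_nonneg hd.le _)]
  congr 1
  have h3 : 1 - (y - s) / (u - s) = (u - y) / (u - s) := by
    field_simp
    ring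
  rw [h3, abs_of_pos (one_div_pos.mpr hd), Real.div_rpow h1.le hd.le, Real.div_rpow h2.le hd.le,
    show a + b - 1 = (a - 1) + (b - 1) + 1 by ring, Real.rpow_add hd, Real.rpow_add hd,
    Real.rpow_one]
  have h4 := (Real.rpow_pos_of_pos hd (a - 1)).ne'
  have h5 := (Real.rpow_pos_of_pos hd (b - 1)).ne'
  field_simp

/-- Copson's factorisation of the Riesz kernel `|x - y| ^ (2 * γ - 1)`. -/
lemma lintegral_copson {γ x y : ℝ} (hγ : 0 < γ) (hγ' : γ < 1 / 2) (hx : 0 < x) (hxy : x < y) :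
    ∫⁻ t in Ioo 0 x, ENNReal.ofReal
        (t ^ (-(2 * γ)) * (x - t) ^ (γ - 1) * (y - t) ^ (γ - 1)) =
      ENNReal.ofReal (x ^ (-γ) * y ^ (-γ) * (y - x) ^ (2 * γ - 1) *
        ProbabilityTheory.beta (1 - 2 * γ) γ) := by
  have hd : 0 < y - x := sub_pos.mpr hxy
  have hy : 0 < y := hx.trans hxy
  have himg : (fun t => (y - x) * t / (x * (y - t))) '' Ioo 0 x = Ioo 0 1 := by
    refine image_Ioo_eq (g := fun v => x * y * v / ((y - x) + x * v)) ?_ ?_ ?_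
    · rintro t ⟨h1, h2⟩
      have h3 : 0 < y - t := by linarith
      refine ⟨by positivity, (div_lt_one (by positivity)).mpr ?_⟩
      nlinarith
    · rintro v ⟨h1, h2⟩
      have h3 : 0 < y - x + x * v := by positivity
      refine ⟨by positivity, (div_lt_iff₀ h3).mpr ?_⟩
      have : 0 < x * ((y - x) * (1 - v)) := mul_pos hx (mul_pos hd (by linarith))
      nlinarith
    · rintro v ⟨h1, h2⟩
      have h3 : 0 < y - x + x * v := by positivity
      have h4 : y - x * y * v / (y - x + x * v) = y * (y - x) / (y - x + x * v) := by
        field_simp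
        ring
      rw [h4]
      field_simp
  have hderiv : ∀ t ∈ Ioo 0 x, HasDerivWithinAt (fun t => (y - x) * t / (x * (y - t)))
      (y * (y - x) / (x * (y - t) ^ (2 : ℝ))) (Ioo 0 x) t := by
    rintro t ⟨h1, h2⟩
    have h3 : 0 < y - t := by linarith
    have h4 := ((hasDerivAt_id t).const_mul (y - x)).div
      (((hasDerivAt_id t).const_sub y).const_mul x) (mul_pos hx h3).ne'
    refine h4.hasDerivWithinAt.congr_deriv ?_
    rw [Real.rpow_two, id_eq]
    field_simp
    ring
  have hinj : InjOn (fun t => (y - x) * t / (x * (y - t))) (Ioo 0 x) := by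
    rintro t ⟨_, h1⟩ t' ⟨_, h2⟩ h
    have h3 : 0 < y - t := by linarith
    have h4 : 0 < y - t' := by linarith
    have h5 := (div_eq_div_iff (mul_pos hx h3).ne' (mul_pos hx h4).ne').mp h
    have h6 : ((y - x) * x * y) * (t - t') = 0 := by linear_combination h5
    have h7 : (y - x) * x * y ≠ 0 := by positivity
    have := (mul_eq_zero.mp h6).resolve_left h7
    linarith
  have key := lintegral_image_eq_lintegral_abs_deriv_mul measurableSet_Ioo hderiv hinj
    (fun t => ENNReal.ofReal (t ^ (1 - 2 * γ - 1) * (1 - t) ^ (γ - 1)))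
  rw [himg, lintegral_beta (by linarith) hγ] at key
  rw [ENNReal.ofReal_mul (by positivity), key, ← lintegral_const_mul' _ _ ENNReal.ofReal_ne_top]
  refine setLIntegral_congr_fun measurableSet_Ioo fun t ht => ?_
  obtain ⟨ht0, htx⟩ := ht
  have h1 : 0 < x - t := sub_pos.mpr htx
  have h2 : 0 < y - t := by linarith
  rw [← ENNReal.ofReal_mul (abs_nonneg _), ← ENNReal.ofReal_mul (by positivity)]
  congr 1
  have h3 : 1 - (y - x) * t / (x * (y - t)) = y * (x - t) / (x * (y - t)) := by
    field_simp
    ring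
  rw [h3, abs_of_pos (by positivity)]
  refine Real.log_injOn_pos (by simp only [mem_Ioi]; positivity)
    (by simp only [mem_Ioi]; positivity) ?_
  have e1 : Real.log (t ^ (-(2 * γ)) * (x - t) ^ (γ - 1) * (y - t) ^ (γ - 1)) =
      -(2 * γ) * Real.log t + (γ - 1) * Real.log (x - t) + (γ - 1) * Real.log (y - t) := by
    rw [Real.log_mul (by positivity) (by positivity), Real.log_mul (by positivity) (by positivity),
      Real.log_rpow ht0, Real.log_rpow h1, Real.log_rpow h2]
  have e2 : Real.log (x ^ (-γ) * y ^ (-γ) * (y - x) ^ (2 * γ - 1)) =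
      -γ * Real.log x + -γ * Real.log y + (2 * γ - 1) * Real.log (y - x) := by
    rw [Real.log_mul (by positivity) (by positivity), Real.log_mul (by positivity) (by positivity),
      Real.log_rpow hx, Real.log_rpow hy, Real.log_rpow hd]
  have e3 : Real.log (y * (y - x) / (x * (y - t) ^ (2 : ℝ))) =
      Real.log y + Real.log (y - x) - (Real.log x + 2 * Real.log (y - t)) := by
    rw [Real.log_div (by positivity) (by positivity), Real.log_mul hy.ne' hd.ne',
      Real.log_mul hx.ne' (by positivity), Real.log_rpow h2]
  have e4 : Real.log (((y - x) * t / (x * (y - t))) ^ (1 - 2 * γ - 1)) =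
      -(2 * γ) * (Real.log (y - x) + Real.log t - (Real.log x + Real.log (y - t))) := by
    rw [Real.log_rpow (by positivity), Real.log_div (by positivity) (by positivity),
      Real.log_mul hd.ne' ht0.ne', Real.log_mul hx.ne' h2.ne']
    ring
  have e5 : Real.log ((y * (x - t) / (x * (y - t))) ^ (γ - 1)) =
      (γ - 1) * (Real.log y + Real.log (x - t) - (Real.log x + Real.log (y - t))) := by
    rw [Real.log_rpow (by positivity), Real.log_div (by positivity) (by positivity),
      Real.log_mul hy.ne' h1.ne', Real.log_mul hx.ne' h2.ne']
  rw [e1, Real.log_mul (by positivity) (by positivity), e2,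
    Real.log_mul (by positivity) (by positivity), e3,
    Real.log_mul (by positivity) (by positivity), e4, e5]
  ring

lemma lintegral_copson_abs {γ x y : ℝ} (hγ : 0 < γ) (hγ' : γ < 1 / 2) (hx : 0 < x) (hy : 0 < y)
    (hxy : x ≠ y) :
    ∫⁻ t in Ioo 0 (min x y), ENNReal.ofReal
        (t ^ (-(2 * γ)) * (x - t) ^ (γ - 1) * (y - t) ^ (γ - 1)) =
      ENNReal.ofReal (x ^ (-γ) * y ^ (-γ) * |x - y| ^ (2 * γ - 1) *
        ProbabilityTheory.beta (1 - 2 * γ) γ) := by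
  rcases lt_or_gt_of_ne hxy with h | h
  · rw [min_eq_left h.le, abs_sub_comm, abs_of_pos (sub_pos.mpr h), lintegral_copson hγ hγ' hx h]
  · rw [min_eq_right h.le, abs_of_pos (sub_pos.mpr h), mul_comm (x ^ (-γ)),
      ← lintegral_copson hγ hγ' hy h]
    simp_rw [mul_right_comm]

lemma beta_self_compl (γ : ℝ) :
    ProbabilityTheory.beta γ (1 - γ) = Real.pi / Real.sin (Real.pi * γ) := by
  rw [ProbabilityTheory.beta, add_sub_cancel, Real.Gamma_one, div_one, Real.Gamma_mul_Gamma_one_sub]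

/-- The Riesz potential of the arcsine-type density is constant on the interval. -/
lemma lintegral_riesz_potential {γ x : ℝ} (hγ : 0 < γ) (hγ' : γ < 1 / 2) (hx : 0 < x)
    (hx1 : x < 1) :
    ∫⁻ y in Ioo (0 : ℝ) 1, ENNReal.ofReal (|x - y| ^ (2 * γ - 1) * (y ^ (-γ) * (1 - y) ^ (-γ))) =
      ENNReal.ofReal (Real.pi / Real.sin (Real.pi * γ)) := by
  set B := ProbabilityTheory.beta (1 - 2 * γ) γ with hB
  have hBpos : 0 < B := ProbabilityTheory.beta_pos (by linarith) hγ
  have hB0 : ENNReal.ofReal B ≠ 0 := by simpa using hBpos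
  let F : ℝ → ℝ → ℝ≥0∞ := fun y t => {p : ℝ × ℝ | p.2 < min x p.1}.indicator
    (fun p => ENNReal.ofReal (x ^ γ * (p.2 ^ (-(2 * γ)) * (x - p.2) ^ (γ - 1)) *
      ((p.1 - p.2) ^ (γ - 1) * (1 - p.1) ^ (-γ)))) (y, t)
  have hmeas : Measurable (Function.uncurry F) := by
    refine Measurable.indicator (by fun_prop) ?_
    exact measurableSet_lt measurable_snd (measurable_const.min measurable_fst)
  have hy : ∀ᵐ y ∂(volume.restrict (Ioo (0 : ℝ) 1)),
      ∫⁻ t in Ioo (0 : ℝ) 1, F y t =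
        ENNReal.ofReal B * ENNReal.ofReal (|x - y| ^ (2 * γ - 1) * (y ^ (-γ) * (1 - y) ^ (-γ))) := by
    have hne : ∀ᵐ y ∂(volume.restrict (Ioo (0 : ℝ) 1)), y ≠ x :=
      ae_restrict_of_ae (compl_mem_ae_iff.mpr (measure_singleton x))
    filter_upwards [hne, ae_restrict_mem measurableSet_Ioo] with y hyx hy
    have hmin : 0 < min x y := lt_min hx hy.1
    have h1y : 0 < 1 - y := sub_pos.mpr hy.2
    have hF : ∀ t, F y t = (Iio (min x y)).indicator (fun t => ENNReal.ofReal
        (x ^ γ * (t ^ (-(2 * γ)) * (x - t) ^ (γ - 1)) *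
          ((y - t) ^ (γ - 1) * (1 - y) ^ (-γ)))) t := by
      intro t
      simp only [F, indicator_apply, mem_ofPred_eq, mem_Iio]
    simp_rw [hF]
    rw [setLIntegral_indicator measurableSet_Iio]
    have hset : Iio (min x y) ∩ Ioo 0 1 = Ioo 0 (min x y) := by
      ext t
      have := min_le_left x y
      simp only [mem_inter_iff, mem_Iio, mem_Ioo]
      constructor
      · rintro ⟨h1, h2, -⟩
        exact ⟨h2, h1⟩
      · rintro ⟨h1, h2⟩
        exact ⟨h2, h1, by linarith⟩
    rw [hset]
    calc _ = ∫⁻ t in Ioo 0 (min x y), ENNReal.ofReal (x ^ γ * (1 - y) ^ (-γ)) * ENNReal.ofReal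
          (t ^ (-(2 * γ)) * (x - t) ^ (γ - 1) * (y - t) ^ (γ - 1)) := by
          refine setLIntegral_congr_fun measurableSet_Ioo fun t ht => ?_
          rw [← ENNReal.ofReal_mul (by positivity)]
          congr 1
          ring
      _ = _ := by
          rw [lintegral_const_mul' _ _ ENNReal.ofReal_ne_top,
            lintegral_copson_abs hγ hγ' hx hy.1 (Ne.symm hyx), ← ENNReal.ofReal_mul (by positivity),
            ← ENNReal.ofReal_mul hBpos.le]
          congr 1
          have : x ^ γ * x ^ (-γ) = 1 := by rw [← Real.rpow_add hx, add_neg_cancel, Real.rpow_zero]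
          linear_combination (1 - y) ^ (-γ) * y ^ (-γ) * |x - y| ^ (2 * γ - 1) * B * this
  have ht : ∀ t ∈ Ioo (0 : ℝ) 1, ∫⁻ y in Ioo (0 : ℝ) 1, F y t = (Iio x).indicator (fun t =>
      ENNReal.ofReal (x ^ γ * (Real.pi / Real.sin (Real.pi * γ))) *
        ENNReal.ofReal ((t - 0) ^ (1 - 2 * γ - 1) * (x - t) ^ (γ - 1))) t := by
    intro t ht
    by_cases htx : t < x
    · have hF : ∀ y, F y t = (Ioi t).indicator (fun y => ENNReal.ofReal
          (x ^ γ * (t ^ (-(2 * γ)) * (x - t) ^ (γ - 1)) *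
            ((y - t) ^ (γ - 1) * (1 - y) ^ (-γ)))) y := by
        intro y
        simp only [F, indicator_apply, mem_ofPred_eq, mem_Ioi, lt_min_iff, htx, true_and]
      have hset : Ioi t ∩ Ioo 0 1 = Ioo t 1 := by
        ext y
        have := ht.1
        simp only [mem_inter_iff, mem_Ioi, mem_Ioo]
        constructor
        · rintro ⟨h1, -, h2⟩
          exact ⟨h1, h2⟩
        · rintro ⟨h1, h2⟩
          exact ⟨h1, by linarith, h2⟩
      simp_rw [hF]
      rw [setLIntegral_indicator measurableSet_Ioi, hset, indicator_of_mem (mem_Iio.mpr htx)]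
      have h0 : 0 ≤ x ^ γ * (t ^ (-(2 * γ)) * (x - t) ^ (γ - 1)) := by
        have := ht.1
        have : 0 < x - t := sub_pos.mpr htx
        positivity
      simp_rw [ENNReal.ofReal_mul h0]
      rw [lintegral_const_mul' _ _ ENNReal.ofReal_ne_top]
      have hin := lintegral_beta_Ioo hγ (show 0 < 1 - γ by linarith) ht.2
      rw [show 1 - γ - 1 = -γ by ring, show γ + (1 - γ) - 1 = 0 by ring, Real.rpow_zero, one_mul,
        beta_self_compl] at hin
      have hpi : 0 ≤ Real.pi / Real.sin (Real.pi * γ) := by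
        rw [← beta_self_compl]
        exact (ProbabilityTheory.beta_pos hγ (by linarith)).le
      rw [hin, ← ENNReal.ofReal_mul h0, ← ENNReal.ofReal_mul (by positivity)]
      congr 1
      rw [sub_zero, show 1 - 2 * γ - 1 = -(2 * γ) by ring]
      ring
    · rw [indicator_of_notMem (by simpa using htx)]
      have hF : ∀ y, F y t = 0 := by
        intro y
        refine indicator_of_notMem ?_ _
        simp [htx]
      simp [hF]
  have hswap : ∫⁻ y in Ioo (0 : ℝ) 1, ∫⁻ t in Ioo (0 : ℝ) 1, F y t =
      ∫⁻ t in Ioo (0 : ℝ) 1, ∫⁻ y in Ioo (0 : ℝ) 1, F y t :=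
    lintegral_lintegral_swap hmeas.aemeasurable
  have hset : Iio x ∩ Ioo 0 1 = Ioo 0 x := by
    ext t
    simp only [mem_inter_iff, mem_Iio, mem_Ioo]
    constructor
    · rintro ⟨h1, h2, -⟩
      exact ⟨h2, h1⟩
    · rintro ⟨h1, h2⟩
      exact ⟨h2, h1, by linarith⟩
  rw [lintegral_congr_ae hy, lintegral_const_mul' _ _ ENNReal.ofReal_ne_top,
    setLIntegral_congr_fun measurableSet_Ioo ht, setLIntegral_indicator measurableSet_Iio, hset,
    lintegral_const_mul' _ _ ENNReal.ofReal_ne_top,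
    lintegral_beta_Ioo (show 0 < 1 - 2 * γ by linarith) hγ hx, sub_zero, ← hB,
    ← ENNReal.ofReal_mul' (by positivity),
    show x ^ γ * (Real.pi / Real.sin (Real.pi * γ)) * (x ^ (1 - 2 * γ + γ - 1) * B) =
      B * (Real.pi / Real.sin (Real.pi * γ)) by
        have : x ^ γ * x ^ (1 - 2 * γ + γ - 1) = 1 := by
          rw [← Real.rpow_add hx, show γ + (1 - 2 * γ + γ - 1) = 0 by ring, Real.rpow_zero]
        linear_combination Real.pi / Real.sin (Real.pi * γ) * B * this,
    ENNReal.ofReal_mul hBpos.le] at hswap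
  exact (ENNReal.mul_right_inj hB0 ENNReal.ofReal_ne_top).mp hswap

lemma sum_setLIntegral_Ioc (f : ℝ → ℝ≥0∞) {Y : ℕ → ℝ} (hY : Monotone Y) (n : ℕ) :
    ∑ i ∈ Finset.Icc 1 n, ∫⁻ y in Ioc (Y (i - 1)) (Y i), f y = ∫⁻ y in Ioc (Y 0) (Y n), f y := by
  induction n with
  | zero => simp
  | succ n ih =>
    rw [Finset.sum_Icc_succ_top (by omega), ih, Nat.add_sub_cancel,
      ← lintegral_union measurableSet_Ioc (Ioc_disjoint_Ioc_of_le le_rfl),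
      Ioc_union_Ioc_eq_Ioc (hY (Nat.zero_le n)) (hY n.le_succ)]

/-- Discrete weights approximating the equilibrium density of the Riesz kernel of order `ν`. -/
lemma exists_weights {ν ε : ℝ} (hν : 0 < ν) (hν1 : ν < 1) (hε : 0 < ε) :
    ∃ W : ℝ, 0 < W ∧ ∀ n : ℕ, 1 ≤ n → ∃ β : ℕ → ℝ,
      (∀ i ∈ Finset.Icc 1 n, 0 ≤ β i ∧ β i ≤ W / n) ∧
      (1 - ε) * ProbabilityTheory.beta ((1 + ν) / 2) ((1 + ν) / 2) ≤ ∑ i ∈ Finset.Icc 1 n, β i ∧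
      ∀ j ∈ Finset.Icc 1 n, ∑ i ∈ Finset.Icc 1 n, β i * (|(i : ℝ) - j| + 1) ^ (-ν) ≤
        (n : ℝ) ^ (-ν) * (Real.pi / Real.cos (Real.pi * ν / 2)) := by
  set γ := (1 - ν) / 2 with hγdef
  have hγ : 0 < γ := by linarith
  have hγ' : γ < 1 / 2 := by linarith
  set B := ProbabilityTheory.beta ((1 + ν) / 2) ((1 + ν) / 2) with hB
  have hBpos : 0 < B := ProbabilityTheory.beta_pos (by linarith) (by linarith)
  let w : ℝ → ℝ := fun y => y ^ (-γ) * (1 - y) ^ (-γ)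
  have hwm : Measurable fun y => ENNReal.ofReal (w y) := by fun_prop
  have htot : ∫⁻ y in Ioo (0 : ℝ) 1, ENNReal.ofReal (w y) = ENNReal.ofReal B := by
    rw [hB, ← lintegral_beta (by linarith) (by linarith),
      show (1 + ν) / 2 - 1 = -γ by rw [hγdef]; ring]
  obtain ⟨θ, hθmass, hθ0, hθ1⟩ : ∃ θ : ℝ, ENNReal.ofReal ((1 - ε) * B) <
      ∫⁻ y in Ioc θ (1 - θ), ENNReal.ofReal (w y) ∧ 0 < θ ∧ θ < 1 / 2 := by
    have ha : Tendsto (fun θ : ℝ => θ) (𝓝[>] 0) (𝓝 0) :=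
      tendsto_nhdsWithin_of_tendsto_nhds tendsto_id
    have hb : Tendsto (fun θ : ℝ => 1 - θ) (𝓝[>] 0) (𝓝 1) := by
      simpa using ha.const_sub 1
    have hlim := (aecover_Ioo_of_Ioc (μ := volume) ha hb).lintegral_tendsto_of_countably_generated
      hwm.aemeasurable
    rw [htot] at hlim
    have hlt : ENNReal.ofReal ((1 - ε) * B) < ENNReal.ofReal B :=
      (ENNReal.ofReal_lt_ofReal_iff hBpos).mpr (by nlinarith)
    obtain ⟨θ, h1, h2⟩ := ((hlim.eventually_const_lt hlt).and
      (Ioo_mem_nhdsGT (show (0 : ℝ) < 1 / 2 by norm_num))).exists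
    refine ⟨θ, h1.trans_le ?_, h2.1, h2.2⟩
    rw [Measure.restrict_restrict measurableSet_Ioc]
    exact lintegral_mono_set inter_subset_left
  refine ⟨θ ^ (-γ) * θ ^ (-γ), by positivity, fun n hn => ?_⟩
  have hn0 : (0 : ℝ) < n := by exact_mod_cast hn
  set h := (1 - 2 * θ) / n with hh
  have hhpos : 0 < h := div_pos (by linarith) hn0
  have hhn : h * n = 1 - 2 * θ := div_mul_cancel₀ _ hn0.ne'
  let Y : ℕ → ℝ := fun i => θ + h * i
  have hYmono : Monotone Y := fun i j hij => by
    have : (i : ℝ) ≤ j := by exact_mod_cast hij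
    simp only [Y]
    nlinarith
  have hY0 : Y 0 = θ := by simp [Y]
  have hYn : Y n = 1 - θ := by
    simp only [Y]
    linarith
  let L : ℕ → ℝ≥0∞ := fun i => ∫⁻ y in Ioc (Y (i - 1)) (Y i), ENNReal.ofReal (w y)
  have hcell : ∀ i ∈ Finset.Icc 1 n, Ioc (Y (i - 1)) (Y i) ⊆ Ioc θ (1 - θ) := by
    intro i hi y hy
    have h1 := hYmono (Nat.zero_le (i - 1))
    have h2 := hYmono (Finset.mem_Icc.mp hi).2
    rw [hY0] at h1
    rw [hYn] at h2
    exact ⟨h1.trans_lt hy.1, hy.2.trans h2⟩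
  have hwidth : ∀ i ∈ Finset.Icc 1 n, Y i - Y (i - 1) = h := by
    intro i hi
    simp only [Y]
    rw [Nat.cast_sub (Finset.mem_Icc.mp hi).1]
    push_cast
    ring
  have hL : ∀ i ∈ Finset.Icc 1 n, L i ≤ ENNReal.ofReal (θ ^ (-γ) * θ ^ (-γ) / n) := by
    intro i hi
    calc L i ≤ ∫⁻ _ in Ioc (Y (i - 1)) (Y i), ENNReal.ofReal (θ ^ (-γ) * θ ^ (-γ)) := by
          refine setLIntegral_mono measurable_const fun y hy => ENNReal.ofReal_le_ofReal ?_
          obtain ⟨h1, h2⟩ := hcell i hi hy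
          exact mul_le_mul (Real.rpow_le_rpow_of_nonpos hθ0 h1.le (by linarith))
            (Real.rpow_le_rpow_of_nonpos hθ0 (by linarith) (by linarith))
            (Real.rpow_nonneg (by linarith) _) (by positivity)
      _ = ENNReal.ofReal (θ ^ (-γ) * θ ^ (-γ) * h) := by
          rw [setLIntegral_const, Real.volume_Ioc, hwidth i hi,
            ← ENNReal.ofReal_mul (by positivity)]
      _ ≤ _ := by
          refine ENNReal.ofReal_le_ofReal ?_
          rw [div_eq_mul_inv]
          refine mul_le_mul_of_nonneg_left ?_ (by positivity)
          rw [hh, ← one_div]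
          exact div_le_div_of_nonneg_right (by linarith) hn0.le
  have hLtop : ∀ i ∈ Finset.Icc 1 n, L i ≠ ⊤ := fun i hi =>
    ne_top_of_le_ne_top ENNReal.ofReal_ne_top (hL i hi)
  refine ⟨fun i => (L i).toReal, fun i hi => ⟨ENNReal.toReal_nonneg,
    ENNReal.toReal_le_of_le_ofReal (by positivity) (hL i hi)⟩, ?_, fun j hj => ?_⟩
  · have hsum : ∑ i ∈ Finset.Icc 1 n, L i = ∫⁻ y in Ioc θ (1 - θ), ENNReal.ofReal (w y) := by
      rw [sum_setLIntegral_Ioc _ hYmono, hY0, hYn]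
    rw [← ENNReal.toReal_sum hLtop, hsum]
    refine (ENNReal.ofReal_le_iff_le_toReal ?_).mp hθmass.le
    rw [← hsum]
    exact (ENNReal.sum_lt_top.mpr fun i hi => (hLtop i hi).lt_top).ne
  · have hYj : 0 < Y j ∧ Y j < 1 := by
      obtain ⟨h1, h2⟩ := Finset.mem_Icc.mp hj
      have h3 := hYmono (Nat.zero_le j)
      have h4 := hYmono h2
      constructor <;> linarith
    have hcos : Real.sin (Real.pi * γ) = Real.cos (Real.pi * ν / 2) := by
      rw [← Real.cos_pi_div_two_sub]
      congr 1
      rw [hγdef]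
      ring
    have hcospos : 0 < Real.cos (Real.pi * ν / 2) := by
      have := Real.pi_pos
      exact Real.cos_pos_of_mem_Ioo ⟨by nlinarith, by nlinarith⟩
    have hker : ∀ i ∈ Finset.Icc 1 n, ENNReal.ofReal ((L i).toReal * (|(i : ℝ) - j| + 1) ^ (-ν)) ≤
        ∫⁻ y in Ioc (Y (i - 1)) (Y i), ENNReal.ofReal (h ^ ν) *
          ENNReal.ofReal (|Y j - y| ^ (2 * γ - 1) * w y) := by
      intro i hi
      rw [ENNReal.ofReal_mul ENNReal.toReal_nonneg, ENNReal.ofReal_toReal (hLtop i hi), mul_comm,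
        ← lintegral_const_mul' _ _ ENNReal.ofReal_ne_top]
      refine lintegral_mono_ae ?_
      have hne : ∀ᵐ y ∂(volume.restrict (Ioc (Y (i - 1)) (Y i))), y ≠ Y j :=
        ae_restrict_of_ae (compl_mem_ae_iff.mpr (measure_singleton _))
      filter_upwards [hne, ae_restrict_mem measurableSet_Ioc] with y hyj hy
      have hw : 0 ≤ w y := by
        obtain ⟨h1, h2⟩ := hcell i hi hy
        exact mul_nonneg (Real.rpow_nonneg (by linarith) _) (Real.rpow_nonneg (by linarith) _)
      rw [← ENNReal.ofReal_mul (by positivity), ← ENNReal.ofReal_mul (by positivity)]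
      refine ENNReal.ofReal_le_ofReal ?_
      rw [← mul_assoc (h ^ ν)]
      refine mul_le_mul_of_nonneg_right ?_ hw
      have hpos : 0 < |Y j - y| := abs_pos.mpr (sub_ne_zero.mpr (Ne.symm hyj))
      have hdist : |Y j - y| ≤ h * (|(i : ℝ) - j| + 1) := by
        have h1 : |Y i - y| ≤ h := by
          rw [abs_of_nonneg (sub_nonneg.mpr hy.2), ← hwidth i hi]
          linarith [hy.1]
        have h2 : |Y j - Y i| = h * |(i : ℝ) - j| := by
          rw [abs_sub_comm, show Y i - Y j = h * ((i : ℝ) - j) by simp only [Y]; ring, abs_mul,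
            abs_of_pos hhpos]
        linarith [abs_sub_le (Y j) (Y i) y]
      rw [show 2 * γ - 1 = -ν by rw [hγdef]; ring]
      calc (|(i : ℝ) - j| + 1) ^ (-ν) = h ^ ν * (h * (|(i : ℝ) - j| + 1)) ^ (-ν) := by
            rw [Real.mul_rpow hhpos.le (by positivity), ← mul_assoc, ← Real.rpow_add hhpos,
              add_neg_cancel, Real.rpow_zero, one_mul]
        _ ≤ h ^ ν * |Y j - y| ^ (-ν) := by
            refine mul_le_mul_of_nonneg_left ?_ (by positivity)
            exact Real.rpow_le_rpow_of_nonpos hpos hdist (by linarith)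
    rw [← ENNReal.ofReal_le_ofReal_iff (by positivity),
      ENNReal.ofReal_sum_of_nonneg fun i _ => by positivity]
    calc _ ≤ ∑ i ∈ Finset.Icc 1 n, ∫⁻ y in Ioc (Y (i - 1)) (Y i), ENNReal.ofReal (h ^ ν) *
          ENNReal.ofReal (|Y j - y| ^ (2 * γ - 1) * w y) := Finset.sum_le_sum hker
      _ = ENNReal.ofReal (h ^ ν) * ∫⁻ y in Ioc θ (1 - θ),
          ENNReal.ofReal (|Y j - y| ^ (2 * γ - 1) * w y) := by
          rw [sum_setLIntegral_Ioc _ hYmono, hY0, hYn,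
            lintegral_const_mul' _ _ ENNReal.ofReal_ne_top]
      _ ≤ ENNReal.ofReal (h ^ ν) * ∫⁻ y in Ioo (0 : ℝ) 1,
          ENNReal.ofReal (|Y j - y| ^ (2 * γ - 1) * w y) := by
          gcongr
          intro y hy
          exact ⟨hθ0.trans hy.1, hy.2.trans_lt (by linarith)⟩
      _ ≤ _ := by
          rw [lintegral_riesz_potential hγ hγ' hYj.1 hYj.2, hcos,
            ← ENNReal.ofReal_mul (by positivity)]
          refine ENNReal.ofReal_le_ofReal (mul_le_mul_of_nonneg_right ?_ (by positivity))
          rw [Real.rpow_neg hn0.le, ← Real.inv_rpow hn0.le]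
          refine Real.rpow_le_rpow hhpos.le ?_ hν.le
          rw [hh, ← one_div]
          exact div_le_div_of_nonneg_right (by linarith) hn0.le

lemma Standing.green_le_of_separated {lam dd : V → V → ℝ} {P : V → Measure (ℕ → V)}
    {α ν c₃ C₃ : ℝ} (h : Standing lam dd P α ν c₃ C₃) {ε δ : ℝ} (hε : 0 < ε) (hδ : 0 < δ)
    (hδ1 : δ < 1) :
    ∃ (K : ℕ) (D : ℝ), 0 < D ∧ ∀ t r : ℝ, 1 ≤ t → 1 ≤ r → ∀ y z, (t - δ) * r ≤ dd y z →
      green lam P y z ≤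
        r ^ (-ν) * ((1 + ε) * C₃ * (t + 1) ^ (-ν) + if t < K then D else 0) := by
  obtain ⟨c₂, C₂, hc₂, hcC, -, hg⟩ := h.greenBounds
  have hν := h.nu_pos
  have hC₂ : 0 < C₂ := hc₂.trans_le hcC
  have hC₃ : 0 < C₃ := h.c₃_pos.trans_le h.c₃_le_C₃
  set s := √(1 + ε) with hs
  have hss : s * s = 1 + ε := Real.mul_self_sqrt (by linarith)
  have hs1 : 1 < s := Real.lt_sqrt_of_sq_lt (by linarith)
  set q := s ^ (ν⁻¹) with hq
  have hq1 : 1 < q := Real.one_lt_rpow hs1 (by positivity)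
  have hqν : q ^ ν = s := Real.rpow_inv_rpow (by linarith) hν.ne'
  obtain ⟨M, hM⟩ := h.greenAsymp (s - 1) (by linarith)
  obtain ⟨K, hK⟩ := exists_nat_ge (max (M + 1) ((1 + q * δ) / (q - 1)))
  refine ⟨K, C₂ * (1 - δ) ^ (-ν), mul_pos hC₂ (Real.rpow_pos_of_pos (by linarith) _), ?_⟩
  intro t r ht hr y z hd
  have hr0 : 0 < r := by linarith
  have ht0 : 0 < t - δ := by linarith
  have htr : 0 < (t - δ) * r := mul_pos ht0 hr0
  have hd0 : 0 < dd y z := htr.trans_le hd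
  have hdν : dd y z ^ (-ν) ≤ (t - δ) ^ (-ν) * r ^ (-ν) := by
    rw [← Real.mul_rpow ht0.le hr0.le]
    exact Real.rpow_le_rpow_of_nonpos htr hd (by linarith)
  split_ifs with htK
  · have hyz : y ≠ z := by
      rintro rfl
      exact hd0.ne' (h.dd_self y)
    calc green lam P y z ≤ C₂ * dd y z ^ (-ν) := (hg y z hyz).2
      _ ≤ C₂ * ((1 - δ) ^ (-ν) * r ^ (-ν)) := by
          refine mul_le_mul_of_nonneg_left (hdν.trans ?_) hC₂.le
          refine mul_le_mul_of_nonneg_right ?_ (by positivity)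
          exact Real.rpow_le_rpow_of_nonpos (by linarith) (by linarith) (by linarith)
      _ = r ^ (-ν) * (C₂ * (1 - δ) ^ (-ν)) := by ring
      _ ≤ _ := by
          refine mul_le_mul_of_nonneg_left (le_add_of_nonneg_left ?_) (by positivity)
          positivity
  · have htK' : (K : ℝ) ≤ t := not_lt.mp htK
    have hMd : M ≤ dd y z := by
      have := (le_max_left _ _).trans hK
      nlinarith
    have hqt : (t + 1) / q ≤ t - δ := by
      have h1 := ((le_max_right _ _).trans hK).trans htK'
      rw [div_le_iff₀ (by linarith)] at h1 ⊢
      linarith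
    have hfar := (hM y z hMd).2
    have hgreen : green lam P y z ≤ s * C₃ * dd y z ^ (-ν) := by
      rw [Real.rpow_neg hd0.le, ← div_eq_mul_inv, le_div_iff₀ (by positivity)]
      simpa using hfar
    have hqs : (t - δ) ^ (-ν) ≤ s * (t + 1) ^ (-ν) := by
      refine (Real.rpow_le_rpow_of_nonpos (by positivity) hqt (by linarith)).trans_eq ?_
      rw [Real.div_rpow (by linarith) (by linarith), Real.rpow_neg (by linarith : 0 ≤ q), hqν,
        div_inv_eq_mul, mul_comm]
    calc green lam P y z ≤ s * C₃ * dd y z ^ (-ν) := hgreen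
      _ ≤ s * C₃ * (s * (t + 1) ^ (-ν) * r ^ (-ν)) := by
          refine mul_le_mul_of_nonneg_left (hdν.trans ?_) (by positivity)
          exact mul_le_mul_of_nonneg_right hqs (by positivity)
      _ = r ^ (-ν) * ((s * s) * C₃ * (t + 1) ^ (-ν) + 0) := by ring
      _ = _ := by rw [hss]

lemma Standing.capa_nonneg {lam dd : V → V → ℝ} {P : V → Measure (ℕ → V)}
    {α ν c₃ C₃ : ℝ} (h : Standing lam dd P α ν c₃ C₃) (K : Set V) : 0 ≤ capa lam P K :=
  tsum_nonneg fun x => h.equi_nonneg K x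

lemma card_filter_abs_sub_lt_le (T : Finset ℕ) (j K : ℕ) :
    (T.filter fun i : ℕ => |(i : ℝ) - j| < K).card ≤ 2 * K := by
  calc _ ≤ (Finset.Ico (j - K) (j + K)).card := by
        refine Finset.card_le_card fun i hi => ?_
        obtain ⟨h1, h2⟩ := abs_lt.mp (Finset.mem_filter.mp hi).2
        have h3 : j < i + K := by
          have : (j : ℝ) < i + K := by linarith
          exact_mod_cast this
        have h4 : i < j + K := by
          have : (i : ℝ) < j + K := by linarith
          exact_mod_cast this
        rw [Finset.mem_Ico]
        omega
    _ ≤ 2 * K := by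
        rw [Nat.card_Ico]
        omega

lemma Standing.sum_weights_le {lam dd : V → V → ℝ} {P : V → Measure (ℕ → V)}
    {α ν c₃ C₃ : ℝ} (h : Standing lam dd P α ν c₃ C₃) {ε δ : ℝ} (hε : 0 < ε) (hδ : 0 < δ)
    (hδ1 : δ < 1) :
    ∃ L : ℝ, 0 ≤ L ∧ ∀ (n : ℕ) (r κ Q W : ℝ) (A : Finset ℕ) (S : ℕ → Set V) (β : ℕ → ℝ),
      1 ≤ r → 0 < κ → A ⊆ Finset.Icc 1 n →
      (∀ i ∈ A, (S i).Finite ∧ (S i).Nonempty ∧ κ ≤ capa lam P (S i)) →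
      (∀ i ∈ A, ∀ j ∈ A, i ≠ j → ∀ y ∈ S i, ∀ z ∈ S j,
        (|(i : ℝ) - (j : ℝ)| - δ) * r ≤ dd y z) →
      (∀ i ∈ Finset.Icc 1 n, 0 ≤ β i ∧ β i ≤ W) →
      (∀ j ∈ Finset.Icc 1 n,
        ∑ i ∈ Finset.Icc 1 n, β i * (|(i : ℝ) - j| + 1) ^ (-ν) ≤ Q) →
      ∑ i ∈ A, β i ≤
        (W / κ + r ^ (-ν) * ((1 + ε) * C₃ * Q + L * W)) * capa lam P (⋃ i ∈ A, S i) := by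
  obtain ⟨K, D, hD, hgreen⟩ := h.green_le_of_separated hε hδ hδ1
  refine ⟨2 * K * D, by positivity, ?_⟩
  intro n r κ Q W A S β hr hκ hA hS hsep hβ hQ
  have hC₃ : 0 < C₃ := h.c₃_pos.trans_le h.c₃_le_C₃
  have hr0 : 0 < r := by linarith
  let T : ℕ → Finset V := fun i => if hi : i ∈ A then (hS i hi).1.toFinset else ∅
  have hT : ∀ i ∈ A, (T i : Set V) = S i := fun i hi => by simp [T, hi]
  have hunion : (⋃ i ∈ A, S i) = ↑(A.biUnion T) := by
    rw [Finset.coe_biUnion]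
    exact iUnion₂_congr fun i hi => (hT i hi).symm
  let Γ : ℕ → ℕ → ℝ := fun i j => r ^ (-ν) *
    ((1 + ε) * C₃ * (|(i : ℝ) - j| + 1) ^ (-ν) + if |(i : ℝ) - j| < K then D else 0)
  have hΓ0 : ∀ i j, 0 ≤ Γ i j := fun i j => by
    have : 0 ≤ if |(i : ℝ) - j| < K then D else 0 := by split_ifs <;> positivity
    positivity
  rw [hunion]
  refine h.sum_le_mul_capa A T hκ (fun i hi => ?_) β (fun i hi => (hβ i (hA hi)).1) Γ ?_ ?_
  · rw [hT i hi]
    exact (hS i hi).2.2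
  · intro i hi j hj hij y hy z hz
    rw [← Finset.mem_coe, hT i hi] at hy
    rw [← Finset.mem_coe, hT j hj] at hz
    refine hgreen _ r ?_ hr y z (hsep i hi j hj hij y hy z hz)
    have h1 : (1 : ℤ) ≤ |(i : ℤ) - j| := Int.one_le_abs (sub_ne_zero.mpr (by exact_mod_cast hij))
    exact_mod_cast h1
  · intro j hj
    have hj' := hA hj
    refine add_le_add (div_le_div_of_nonneg_right (hβ j hj').2 hκ.le) ?_
    have hnear : ∑ i ∈ Finset.Icc 1 n, β i * (if |(i : ℝ) - j| < K then D else 0) ≤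
        2 * K * D * W := by
      have hW : 0 ≤ W := (hβ j hj').1.trans (hβ j hj').2
      simp_rw [mul_ite, mul_zero]
      rw [← Finset.sum_filter]
      calc _ ≤ ∑ i ∈ (Finset.Icc 1 n).filter (fun i : ℕ => |(i : ℝ) - j| < K), W * D :=
            Finset.sum_le_sum fun i hi =>
              mul_le_mul_of_nonneg_right (hβ i (Finset.mem_filter.mp hi).1).2 hD.le
        _ ≤ (2 * K : ℕ) * (W * D) := by
            rw [Finset.sum_const, nsmul_eq_mul]
            exact mul_le_mul_of_nonneg_right
              (Nat.cast_le.mpr (card_filter_abs_sub_lt_le _ j K)) (by positivity)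
        _ = 2 * K * D * W := by
            push_cast
            ring
    refine (Finset.sum_le_sum_of_subset_of_nonneg ((Finset.erase_subset _ _).trans hA)
      fun i hi _ => mul_nonneg (hβ i hi).1 (hΓ0 i j)).trans ?_
    calc ∑ i ∈ Finset.Icc 1 n, β i * Γ i j
        = r ^ (-ν) * ((1 + ε) * C₃ * ∑ i ∈ Finset.Icc 1 n, β i * (|(i : ℝ) - j| + 1) ^ (-ν) +
          ∑ i ∈ Finset.Icc 1 n, β i * (if |(i : ℝ) - j| < K then D else 0)) := by
          rw [Finset.mul_sum, ← Finset.sum_add_distrib, Finset.mul_sum]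
          refine Finset.sum_congr rfl fun i _ => ?_
          simp only [Γ]
          ring
      _ ≤ _ := by
          have := hQ j hj'
          gcongr

/-- Weights with small interaction energy bound the capacity of a spread-out union from below. -/
lemma Standing.inv_le_capa_of_weights {lam dd : V → V → ℝ} {P : V → Measure (ℕ → V)}
    {α ν c₃ C₃ : ℝ} (h : Standing lam dd P α ν c₃ C₃) {ε δ : ℝ} (hε : 0 < ε) (hδ : 0 < δ)
    (hδ1 : δ < 1) :
    ∃ L : ℝ, 0 ≤ L ∧ ∀ (n : ℕ) (r κ Q W m Y : ℝ) (A : Finset ℕ) (S : ℕ → Set V) (β : ℕ → ℝ),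
      1 ≤ n → 1 ≤ r → 0 < κ → 0 < W → 0 < m → 0 < Y → A ⊆ Finset.Icc 1 n →
      (∀ i ∈ A, (S i).Finite ∧ (S i).Nonempty ∧ κ ≤ capa lam P (S i)) →
      (∀ i ∈ A, ∀ j ∈ A, i ≠ j → ∀ y ∈ S i, ∀ z ∈ S j,
        (|(i : ℝ) - (j : ℝ)| - δ) * r ≤ dd y z) →
      (∀ i ∈ Finset.Icc 1 n, 0 ≤ β i ∧ β i ≤ W / n) →
      (∀ j ∈ Finset.Icc 1 n,
        ∑ i ∈ Finset.Icc 1 n, β i * (|(i : ℝ) - j| + 1) ^ (-ν) ≤ Q) →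
      m ≤ ∑ i ∈ A, β i →
      r ^ (-ν) * ((1 + ε) * C₃ * Q + L * (W / n)) ≤ m * Y →
      (1 / (m / W * κ * n) + Y)⁻¹ ≤ capa lam P (⋃ i ∈ A, S i) := by
  obtain ⟨L, hL, hsum⟩ := h.sum_weights_le hε hδ hδ1
  refine ⟨L, hL, ?_⟩
  intro n r κ Q W m Y A S β hn hr hκ hW hm hY hA hS hsep hβ hQ hmass hbound
  have hn0 : (0 : ℝ) < n := by exact_mod_cast hn
  have h1 := hmass.trans (hsum n r κ Q (W / n) A S β hr hκ hA hS hsep hβ hQ)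
  have hcap := h.capa_nonneg (⋃ i ∈ A, S i)
  have h2 : W / n / κ = m * (1 / (m / W * κ * n)) := by
    field_simp
  have h3 : m ≤ m * (1 / (m / W * κ * n) + Y) * capa lam P (⋃ i ∈ A, S i) := by
    refine h1.trans (mul_le_mul_of_nonneg_right ?_ hcap)
    rw [mul_add m, ← h2]
    exact add_le_add_right hbound _
  have hpos : 0 < 1 / (m / W * κ * n) + Y := by positivity
  rw [inv_le_iff_one_le_mul₀' hpos]
  exact le_of_mul_le_mul_left (by linarith) hm

lemma sum_Icc_abs_sub_le (f : ℕ → ℝ) (hf : ∀ k, 0 ≤ f k) {n j : ℕ} (hj : j ∈ Finset.Icc 1 n) :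
    ∑ i ∈ Finset.Icc 1 n, f (Nat.dist i j) ≤ 2 * ∑ k ∈ Finset.range n, f k := by
  obtain ⟨h1, h2⟩ := Finset.mem_Icc.mp hj
  have hmem : ∀ i ∈ Finset.Icc 1 n, Nat.dist i j ∈ Finset.range n := fun i hi => by
    rw [Finset.mem_Icc] at hi
    rw [Finset.mem_range, Nat.dist]
    omega
  rw [← Finset.sum_fiberwise_of_maps_to hmem, Finset.mul_sum]
  refine Finset.sum_le_sum fun k _ => ?_
  rw [Finset.sum_congr rfl fun i hi => by rw [(Finset.mem_filter.mp hi).2], Finset.sum_const,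
    nsmul_eq_mul]
  refine mul_le_mul_of_nonneg_right ?_ (hf k)
  have hsub : (Finset.Icc 1 n).filter (fun i => Nat.dist i j = k) ⊆ {j - k, j + k} := fun i hi => by
    have := (Finset.mem_filter.mp hi).2
    rw [Nat.dist] at this
    rw [Finset.mem_insert, Finset.mem_singleton]
    omega
  exact_mod_cast (Finset.card_le_card hsub).trans Finset.card_le_two

lemma sum_Icc_rpow_abs_sub_le (ν : ℝ) {n j : ℕ} (hj : j ∈ Finset.Icc 1 n) :
    ∑ i ∈ Finset.Icc 1 n, (|(i : ℝ) - j| + 1) ^ (-ν) ≤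
      2 * ∑ k ∈ Finset.range n, ((k : ℝ) + 1) ^ (-ν) := by
  refine le_of_eq_of_le (Finset.sum_congr rfl fun i _ => ?_)
    (sum_Icc_abs_sub_le (fun k => ((k : ℝ) + 1) ^ (-ν)) (fun k => by positivity) hj)
  congr 2
  rcases le_total i j with hij | hij
  · rw [Nat.dist_eq_sub_of_le hij, Nat.cast_sub hij, abs_sub_comm, abs_of_nonneg]
    exact sub_nonneg.mpr (by exact_mod_cast hij)
  · rw [Nat.dist_eq_sub_of_le_right hij, Nat.cast_sub hij, abs_of_nonneg]
    exact sub_nonneg.mpr (by exact_mod_cast hij)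

lemma sum_range_inv_le {n : ℕ} :
    ∑ k ∈ Finset.range n, ((k : ℝ) + 1) ^ (-1 : ℝ) ≤ 1 + Real.log n := by
  have h := harmonic_le_one_add_log n
  rw [harmonic] at h
  push_cast at h
  simpa only [Real.rpow_neg_one] using h

lemma exists_sum_range_rpow_le {ν : ℝ} (hν : 1 < ν) :
    ∃ Z : ℝ, 0 < Z ∧ ∀ n : ℕ, ∑ k ∈ Finset.range n, ((k : ℝ) + 1) ^ (-ν) ≤ Z := by
  have hs : Summable fun k : ℕ => ((k : ℝ) + 1) ^ (-ν) := by
    have := (summable_nat_add_iff 1).mpr (Real.summable_nat_rpow.mpr (neg_lt_neg hν))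
    simpa using this
  refine ⟨∑' k : ℕ, ((k : ℝ) + 1) ^ (-ν), hs.tsum_pos (fun k => by positivity) 0 (by positivity),
    fun n => hs.sum_le_tsum _ fun k _ => by positivity⟩

/-- Removing a small proportion of the indices loses little mass of a family of bounded weights. -/
lemma sub_le_sum_of_card {n : ℕ} {A : Finset ℕ} {β : ℕ → ℝ} {W c : ℝ} (hn : 1 ≤ n)
    (hA : A ⊆ Finset.Icc 1 n) (hc : c * n ≤ A.card) (hW : 0 < W)
    (hβ : ∀ i ∈ Finset.Icc 1 n, β i ≤ W / n) :
    ∑ i ∈ Finset.Icc 1 n, β i - (1 - c) * W ≤ ∑ i ∈ A, β i := by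
  have hn0 : (0 : ℝ) < n := by exact_mod_cast hn
  rw [← Finset.sum_sdiff hA]
  have h1 : ∑ i ∈ Finset.Icc 1 n \ A, β i ≤ ((Finset.Icc 1 n \ A).card : ℝ) * (W / n) := by
    rw [← nsmul_eq_mul]
    exact Finset.sum_le_card_nsmul _ _ _ fun i hi => hβ i (Finset.mem_sdiff.mp hi).1
  have h2 : ((Finset.Icc 1 n \ A).card : ℝ) * (W / n) ≤ ((1 - c) * n) * (W / n) := by
    refine mul_le_mul_of_nonneg_right ?_ (by positivity)
    rw [Finset.card_sdiff_of_subset hA, Nat.cast_sub (Finset.card_le_card hA), Nat.card_Icc,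
      Nat.add_sub_cancel]
    linarith
  have h3 : ((1 - c) * n) * (W / n) = (1 - c) * W := by field_simp
  linarith

lemma kappaNu_of_lt_one {ν : ℝ} (hν : ν < 1) : kappaNu ν =
    ProbabilityTheory.beta ((1 + ν) / 2) ((1 + ν) / 2) * Real.cos (Real.pi * ν / 2) / Real.pi := by
  rw [kappaNu, if_pos hν, ProbabilityTheory.beta, add_halves]

/-- lower bound on the capacity of a union of spread-out sets,
Lemma `lem:capatube`, lower bound `eq:capunionbound`. -/
theorem statement8
    (V : Type) [MeasurableSpace V]
    (lam dd : V → V → ℝ) (P : V → Measure (ℕ → V)) (α ν c₃ C₃ : ℝ)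
    (hSt : Standing lam dd P α ν c₃ C₃) :
    ∀ η δ : ℝ, η ∈ Set.Ioo (0:ℝ) 1 → δ ∈ Set.Ioo (0:ℝ) 1 →
    ∃ ca cb CP c₆ : ℝ, ca ∈ Set.Ioo (0:ℝ) 1 ∧ 0 < cb ∧ 0 < CP ∧ 0 < c₆ ∧
      (ν ≤ 1 → c₆ = cBeta ν C₃) ∧
      ∀ (N : ℝ) (Pn : ℕ) (A : Finset ℕ) (S : ℕ → Set V) (κ : ℝ),
        CP ≤ N → CP ≤ (Pn : ℝ) → (Pn : ℝ) ≤ N → 0 < κ →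
        A ⊆ Finset.Icc 1 Pn →
        ca * (Pn : ℝ) ≤ (A.card : ℝ) →
        (∀ i ∈ A, (S i).Finite ∧ (S i).Nonempty ∧ κ ≤ capa lam P (S i)) →
        (∀ i ∈ A, ∀ j ∈ A, i ≠ j → ∀ y ∈ S i, ∀ z ∈ S j,
          (|(i : ℝ) - (j : ℝ)| - δ) * (N / (Pn : ℝ)) ≤ dd y z) →
        (1 / (cb * κ * (Pn : ℝ)) + (1 + η) / (c₆ * Fnu ν N (N / (Pn : ℝ))))⁻¹
          ≤ capa lam P (⋃ i ∈ A, S i) := by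
  intro η δ hη hδ
  obtain ⟨hη0, hη1⟩ := hη
  obtain ⟨hδ0, hδ1⟩ := hδ
  have hν := hSt.nu_pos
  have hC₃ : 0 < C₃ := hSt.c₃_pos.trans_le hSt.c₃_le_C₃
  have hπ := Real.pi_pos
  rcases lt_trichotomy ν 1 with hν1 | hν1 | hν1
  · set B := ProbabilityTheory.beta ((1 + ν) / 2) ((1 + ν) / 2) with hB
    have hBpos : 0 < B := ProbabilityTheory.beta_pos (by linarith) (by linarith)
    have hcos : 0 < Real.cos (Real.pi * ν / 2) :=
      Real.cos_pos_of_mem_Ioo ⟨by nlinarith, by nlinarith⟩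
    have hc₆ : cBeta ν C₃ = B * Real.cos (Real.pi * ν / 2) / Real.pi / C₃ := by
      rw [cBeta, kappaNu_of_lt_one hν1]
    set T := C₃ * (Real.pi / Real.cos (Real.pi * ν / 2)) with hT
    have hTpos : 0 < T := by positivity
    have hε : 0 < η / 10 := by linarith
    obtain ⟨W, hW, hweights⟩ := exists_weights hν hν1 hε
    obtain ⟨L, hL, hmain⟩ := hSt.inv_le_capa_of_weights hε hδ0 hδ1
    have hlim : Tendsto (fun x : ℝ => L * W * x ^ (-(1 - ν))) atTop (𝓝 0) := by
      simpa using (tendsto_rpow_neg_atTop (sub_pos.mpr hν1)).const_mul (L * W)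
    obtain ⟨x₀, hx₀⟩ := eventually_atTop.mp
      (hlim.eventually_le_const (show 0 < η / 2 * T by positivity))
    have hm : 0 < (1 - η / 5) * B := mul_pos (by linarith) hBpos
    have hmin : 0 < min (1 / 2) (η / 10 * B / W) := lt_min (by norm_num) (by positivity)
    refine ⟨1 - min (1 / 2) (η / 10 * B / W), (1 - η / 5) * B / W, max 1 x₀, cBeta ν C₃,
      ⟨by linarith [min_le_left (1 / 2) (η / 10 * B / W)], by linarith⟩, by positivity,
      by positivity, by rw [hc₆]; positivity, fun _ => rfl, ?_⟩
    intro N n A S κ hCN hCn hnN hκ hA hcard hS hsep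
    have hn1 : (1 : ℝ) ≤ n := (le_max_left _ _).trans hCn
    have hn : 1 ≤ n := by exact_mod_cast hn1
    have hn0 : (0 : ℝ) < n := by linarith
    have hN0 : 0 < N := by linarith
    obtain ⟨β, hβ, hmass, hpot⟩ := hweights n hn
    have hF : Fnu ν N (N / n) = N ^ ν := by rw [Fnu, if_pos hν1]
    rw [hF]
    refine hmain n (N / n) κ _ W _ _ A S β hn ((one_le_div hn0).mpr hnN) hκ hW hm
      (by rw [hc₆]; positivity) hA hS hsep hβ hpot ?_ ?_
    · have h1 := sub_le_sum_of_card hn hA hcard hW fun i hi => (hβ i hi).2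
      have h2 : (1 - (1 - min (1 / 2) (η / 10 * B / W))) * W ≤ η / 10 * B := by
        rw [← le_div_iff₀ hW]
        linarith [min_le_right (1 / 2) (η / 10 * B / W)]
      linarith
    · have h1 := hx₀ n ((le_max_right _ _).trans hCn)
      have h2 : (n : ℝ) ^ ν * (n : ℝ) ^ (-ν) = 1 := by
        rw [← Real.rpow_add hn0, add_neg_cancel, Real.rpow_zero]
      have h3 : (n : ℝ) ^ ν / n = (n : ℝ) ^ (-(1 - ν)) := by
        rw [neg_sub, Real.rpow_sub_one hn0.ne']
      have h4 : (N / n) ^ (-ν) = (N ^ ν)⁻¹ * (n : ℝ) ^ ν := by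
        rw [Real.div_rpow hN0.le hn0.le, Real.rpow_neg hN0.le, Real.rpow_neg hn0.le,
          div_inv_eq_mul]
      calc _ = (N ^ ν)⁻¹ * ((1 + η / 10) * T * ((n : ℝ) ^ ν * (n : ℝ) ^ (-ν)) +
            L * W * ((n : ℝ) ^ ν / n)) := by
            rw [h4]
            ring
        _ ≤ (N ^ ν)⁻¹ * ((1 - η / 5) * (1 + η) * T) := by
            rw [h2, h3]
            refine mul_le_mul_of_nonneg_left ?_ (by positivity)
            nlinarith [mul_pos hη0 hTpos]
        _ = _ := by
            rw [hc₆, hT]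
            field_simp
  · subst hν1
    have hc₆ : cBeta 1 C₃ = 1 / 2 / C₃ := by rw [cBeta, kappaNu, if_neg (lt_irrefl _)]
    have hε : 0 < η / 10 := by linarith
    obtain ⟨L, hL, hmain⟩ := hSt.inv_le_capa_of_weights hε hδ0 hδ1
    obtain ⟨x₀, hx₀⟩ := eventually_atTop.mp
      (Real.tendsto_log_atTop.eventually_ge_atTop ((2 * C₃ * (1 + η / 10) + L) / (η * C₃)))
    have hca : 0 < 1 - η / 5 := by linarith
    refine ⟨1 - η / 5, (1 - η / 5) / 1, max 1 x₀, cBeta 1 C₃, ⟨hca, by linarith⟩, by positivity,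
      by positivity, by rw [hc₆]; positivity, fun _ => rfl, ?_⟩
    intro N n A S κ hCN hCn hnN hκ hA hcard hS hsep
    have hn1 : (1 : ℝ) ≤ n := (le_max_left _ _).trans hCn
    have hn : 1 ≤ n := by exact_mod_cast hn1
    have hn0 : (0 : ℝ) < n := by linarith
    have hN0 : 0 < N := by linarith
    have hF : Fnu 1 N (N / n) = N / max 1 (Real.log n) := by
      rw [Fnu, if_neg (lt_irrefl _), if_pos rfl, div_div_cancel₀ hN0.ne']
    rw [hF]
    have hmax : 0 < max 1 (Real.log n) := by positivity
    refine hmain n (N / n) κ (1 / n * (2 * (1 + Real.log n))) 1 _ _ A S (fun _ => 1 / n) hn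
      ((one_le_div hn0).mpr hnN) hκ one_pos hca (by rw [hc₆]; positivity) hA hS hsep
      (fun i _ => ⟨by positivity, le_rfl⟩) (fun j hj => ?_) ?_ ?_
    · rw [← Finset.mul_sum]
      refine mul_le_mul_of_nonneg_left ((sum_Icc_rpow_abs_sub_le 1 hj).trans ?_) (by positivity)
      linarith [sum_range_inv_le (n := n)]
    · rw [Finset.sum_const, nsmul_eq_mul, mul_one_div, le_div_iff₀ hn0]
      exact hcard
    · have h1 := hx₀ n ((le_max_right _ _).trans hCn)
      rw [div_le_iff₀ (by positivity)] at h1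
      have hlog := le_max_right 1 (Real.log n)
      calc _ = N⁻¹ * ((1 + η / 10) * C₃ * (2 * (1 + Real.log n)) + L) := by
            rw [Real.rpow_neg_one]
            field_simp
        _ ≤ N⁻¹ * ((1 - η / 5) * (1 + η) * (2 * C₃) * max 1 (Real.log n)) := by
            refine mul_le_mul_of_nonneg_left ?_ (by positivity)
            have h2 : (1 + η / 2 + η / 10) * (2 * C₃ * max 1 (Real.log n)) ≤
                (1 - η / 5) * (1 + η) * (2 * C₃ * max 1 (Real.log n)) :=
              mul_le_mul_of_nonneg_right (by nlinarith) (by positivity)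
            have h3 : (1 + η / 2 + η / 10) * (2 * C₃ * Real.log n) ≤
                (1 + η / 2 + η / 10) * (2 * C₃ * max 1 (Real.log n)) := by gcongr
            linarith
        _ = _ := by
            rw [hc₆]
            field_simp
  · obtain ⟨L, hL, hmain⟩ := hSt.inv_le_capa_of_weights one_pos hδ0 hδ1
    obtain ⟨Z, hZ, hZsum⟩ := exists_sum_range_rpow_le hν1
    set c := 1 / 2 / ((1 + 1) * C₃ * (2 * Z) + L) with hc
    have hcpos : 0 < c := by positivity
    refine ⟨1 / 2, 1 / 2 / 1, 1, c, by norm_num, by norm_num, one_pos, hcpos,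
      fun h => absurd h (not_le.mpr hν1), ?_⟩
    intro N n A S κ hCN hn1 hnN hκ hA hcard hS hsep
    have hn : 1 ≤ n := by exact_mod_cast hn1
    have hn0 : (0 : ℝ) < n := by linarith
    have hN0 : 0 < N := by linarith
    have hr0 : 0 < N / n := by positivity
    have hF : Fnu ν N (N / n) = N * (N / n) ^ (ν - 1) := by
      rw [Fnu, if_neg hν1.not_gt, if_neg hν1.ne']
    rw [hF]
    refine hmain n (N / n) κ (1 / n * (2 * Z)) 1 _ _ A S (fun _ => 1 / n) hn
      ((one_le_div hn0).mpr hnN) hκ one_pos one_half_pos (by positivity) hA hS hsep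
      (fun i _ => ⟨by positivity, le_rfl⟩) (fun j hj => ?_) ?_ ?_
    · rw [← Finset.mul_sum]
      refine mul_le_mul_of_nonneg_left ((sum_Icc_rpow_abs_sub_le ν hj).trans ?_) (by positivity)
      linarith [hZsum n]
    · rw [Finset.sum_const, nsmul_eq_mul, mul_one_div, le_div_iff₀ hn0]
      exact hcard
    · have h1 : (N / n) ^ (-ν) = n * (N * (N / n) ^ (ν - 1))⁻¹ := by
        rw [Real.rpow_sub_one hr0.ne', Real.rpow_neg hr0.le]
        field_simp
      calc _ = (N * (N / n) ^ (ν - 1))⁻¹ * ((1 + 1) * C₃ * (2 * Z) + L) := by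
            rw [h1]
            field_simp
        _ ≤ (N * (N / n) ^ (ν - 1))⁻¹ * ((1 + η) * ((1 + 1) * C₃ * (2 * Z) + L)) := by
            refine mul_le_mul_of_nonneg_left ?_ (by positivity)
            exact le_mul_of_one_le_left (by positivity) (by linarith)
        _ = _ := by
            rw [hc]
            field_simp

end Paper
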